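/- arXiv:1703.00604 — 2 statements merged into one kernel-verified Lean document; each statement's English description precedes it below -/
import Mathlib

section
/- Let X₁,…,Xₙ be a sequence of independent random variables in a sublinear expectation space (Ω, H, Ê) with Ê(Xₖ) ≤ 0 for k = 1,…,n, and let 1 ≤ p ≤ 2 with Ê(|Xₖ|^p) < ∞ for each k. Set Sₖ = X₁ + ⋯ + Xₖ. Then Ê(|max_{1≤k≤n}(Sₙ − Sₖ)|^p) ≤ 2^{2−p} Σ_{k=1}^n Ê(|Xₖ|^p). In particular, Ê((Sₙ⁺)^p) ≤ 2^{2−p} Σ_{k=1}^n Ê(|Xₖ|^p), where Sₙ⁺ = max(Sₙ, 0). -/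
open Filter MeasureTheory Set

/-- The class `C_{l,Lip}` of local Lipschitz functions:
`|φ(x) − φ(y)| ≤ C (1 + ‖x‖^m + ‖y‖^m) ‖x − y‖` for some `C > 0` and `m : ℕ`. -/
def LocLip {α : Type*} [NormedAddCommGroup α] (φ : α → ℝ) : Prop :=
  ∃ C : ℝ, 0 < C ∧ ∃ m : ℕ, ∀ x y : α,
    |φ x - φ y| ≤ C * (1 + ‖x‖ ^ m + ‖y‖ ^ m) * ‖x - y‖

/-- A sublinear expectation space `(Ω, H, Ê)`: `H` is a set of real functions on `Ω`
containing constants, stable under composition with `C_{l,Lip}` functions, and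
`E` is monotone, constant preserving, subadditive and positively homogeneous on `H`. -/
structure SubLinExp (Ω : Type*) where
  H : Set (Ω → ℝ)
  E : (Ω → ℝ) → ℝ
  const_mem : ∀ c : ℝ, (fun _ => c) ∈ H
  comp_mem : ∀ (n : ℕ) (X : Fin n → Ω → ℝ), (∀ i, X i ∈ H) →
    ∀ φ : (Fin n → ℝ) → ℝ, LocLip φ → (fun ω => φ (fun i => X i ω)) ∈ H
  mono : ∀ X ∈ H, ∀ Y ∈ H, (∀ ω, Y ω ≤ X ω) → E Y ≤ E X
  const : ∀ c : ℝ, E (fun _ => c) = c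
  subadd : ∀ X ∈ H, ∀ Y ∈ H, E (fun ω => X ω + Y ω) ≤ E X + E Y
  homog : ∀ l : ℝ, 0 ≤ l → ∀ X ∈ H, E (fun ω => l * X ω) = l * E X

/-- `Y` is independent of the random vector `X = (X₁,…,X_m)`:
`Ê(φ(X,Y)) = Ê(ψ(X))` where `ψ(x) = Ê(φ(x,Y))`, for all `φ ∈ C_{l,Lip}`. -/
def IndepVecOf {Ω : Type*} (S : SubLinExp Ω) {m : ℕ} (Y : Ω → ℝ)
    (X : Fin m → Ω → ℝ) : Prop :=
  ∀ φ : (Fin m → ℝ) → ℝ → ℝ, LocLip (fun q : (Fin m → ℝ) × ℝ => φ q.1 q.2) →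
    S.E (fun ω => φ (fun i => X i ω) (Y ω)) =
      S.E (fun ω => S.E (fun ω' => φ (fun i => X i ω) (Y ω')))

/-- The (1-based) sequence `X₁, X₂, …` is independent:
`X_{i+1}` is independent of `(X₁,…,X_i)` for each `i ≥ 1`. -/
def IndepSeq1 {Ω : Type*} (S : SubLinExp Ω) (X : ℕ → Ω → ℝ) : Prop :=
  ∀ i : ℕ, 1 ≤ i → IndepVecOf S (X (i + 1)) (fun j : Fin i => X ((j : ℕ) + 1))

/-- The (1-based) finite sequence `X₁,…,Xₙ` is independent. -/
def IndepUpTo1 {Ω : Type*} (S : SubLinExp Ω) (X : ℕ → Ω → ℝ) (n : ℕ) : Prop :=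
  ∀ i : ℕ, 1 ≤ i → i + 1 ≤ n → IndepVecOf S (X (i + 1)) (fun j : Fin i => X ((j : ℕ) + 1))

/-- The (1-based) sequence `X₁, X₂, …` is identically distributed. -/
def IdentDist1 {Ω : Type*} (S : SubLinExp Ω) (X : ℕ → Ω → ℝ) : Prop :=
  ∀ i : ℕ, 1 ≤ i → ∀ φ : ℝ → ℝ, LocLip φ →
    S.E (fun ω => φ (X i ω)) = S.E (fun ω => φ (X 1 ω))

/-- A capacity `V` is continuous: `V(Aₙ) ↑ V(A)` if `Aₙ ↑ A` and `V(Aₙ) ↓ V(A)` if `Aₙ ↓ A`. -/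
def ContCapacity {Ω : Type*} (V : Set Ω → ℝ) : Prop :=
  (∀ A : ℕ → Set Ω, Monotone A →
    Tendsto (fun n => V (A n)) atTop (nhds (V (⋃ n, A n)))) ∧
  (∀ A : ℕ → Set Ω, Antitone A →
    Tendsto (fun n => V (A n)) atTop (nhds (V (⋂ n, A n))))

/-- The upper capacity generated by a sublinear expectation: `V(A) = Ê(1_A)`. -/
noncomputable def genV {Ω : Type*} (S : SubLinExp Ω) : Set Ω → ℝ :=
  fun A => S.E (A.indicator fun _ => (1 : ℝ))

/-- The Choquet integral `C_V(Z) = ∫₀^∞ V(Z ≥ t) dt` of a nonnegative random variable. -/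
noncomputable def choquet {Ω : Type*} (V : Set Ω → ℝ) (Z : Ω → ℝ) : ENNReal :=
  ∫⁻ t in Set.Ioi (0 : ℝ), ENNReal.ofReal (V {ω | t ≤ Z ω})

/-- The sublinear expectation `Ê` is regular: `Ê(Xₙ) ↓ 0` whenever `Xₙ(ω) ↓ 0` for every `ω`. -/
def Regular {Ω : Type*} (S : SubLinExp Ω) : Prop :=
  ∀ X : ℕ → Ω → ℝ, (∀ n, X n ∈ S.H) → (∀ ω, Antitone fun n => X n ω) →
    (∀ ω, Tendsto (fun n => X n ω) atTop (nhds 0)) →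
    Tendsto (fun n => S.E (X n)) atTop (nhds 0)

lemma Real.one_add_rpow_le_abs_rpow_add {p t : ℝ} (hp1 : 1 ≤ p) (hp2 : p ≤ 2) (ht : -1 ≤ t) :
    (1 + t) ^ p ≤ |t| ^ p + 1 + p * t := by
  obtain ⟨q, rfl⟩ : ∃ q, p = 1 + q := ⟨p - 1, by ring⟩
  have hq0 : 0 ≤ q := by linarith
  have hq1 : q ≤ 1 := by linarith
  have bern : (1 + t) ^ q ≤ 1 + q * t := rpow_one_add_le_one_add_mul_self ht hq0 hq1
  rw [Real.rpow_one_add' (by linarith) (by linarith),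
    Real.rpow_one_add' (abs_nonneg t) (by linarith)]
  rcases le_total 0 t with h | h
  · have sub := Real.rpow_add_le_add_rpow zero_le_one h hq0 hq1
    rw [Real.one_rpow] at sub
    rw [abs_of_nonneg h]
    nlinarith
  · have sub := Real.rpow_add_le_add_rpow (show 0 ≤ 1 + t by linarith) (neg_nonneg.mpr h) hq0 hq1
    rw [show 1 + t + -t = 1 by ring, Real.one_rpow] at sub
    rw [abs_of_nonpos h]
    nlinarith

lemma Real.max_one_add_rpow_le {p t : ℝ} (hp1 : 1 ≤ p) (hp2 : p ≤ 2) :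
    max (1 + t) 0 ^ p ≤ |t| ^ p + 1 + p * t := by
  rcases le_total (-1) t with h | h
  · rw [max_eq_left (by linarith)]
    exact Real.one_add_rpow_le_abs_rpow_add hp1 hp2 h
  · rw [max_eq_right (by linarith), Real.zero_rpow (by linarith), abs_of_nonpos (by linarith)]
    have bern := one_add_mul_self_le_rpow_one_add (show -1 ≤ -t - 1 by linarith) hp1
    rw [show 1 + (-t - 1) = -t by ring] at bern
    nlinarith

lemma Real.max_add_rpow_le {p m : ℝ} (hp1 : 1 ≤ p) (hp2 : p ≤ 2) (hm : 0 ≤ m) :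
    ∃ c : ℝ, 0 ≤ c ∧ ∀ y : ℝ, max (m + y) 0 ^ p ≤ |y| ^ p + m ^ p + c * y := by
  rcases hm.eq_or_lt with rfl | hm
  · refine ⟨0, le_rfl, fun y => ?_⟩
    rw [Real.zero_rpow (by linarith), zero_add, add_zero, zero_mul, add_zero]
    exact Real.rpow_le_rpow (le_max_right _ _) (max_le (le_abs_self y) (abs_nonneg y))
      (by linarith)
  · refine ⟨m ^ p * (p / m), by positivity, fun y => ?_⟩
    have key := mul_le_mul_of_nonneg_left
      (Real.max_one_add_rpow_le (t := y / m) hp1 hp2) (Real.rpow_nonneg hm.le p)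
    rw [← Real.mul_rpow hm.le (le_max_right _ _), mul_max_of_nonneg _ _ hm.le, mul_zero,
      mul_add, mul_one, mul_div_cancel₀ y hm.ne'] at key
    have e : m ^ p * |y / m| ^ p = |y| ^ p := by
      rw [← Real.mul_rpow hm.le (abs_nonneg _), abs_div, abs_of_pos hm,
        mul_div_cancel₀ _ hm.ne']
    calc _ ≤ _ := key
      _ = m ^ p * |y / m| ^ p + m ^ p + m ^ p * (p / m) * y := by ring
      _ = _ := by rw [e]

lemma Real.rpow_sub_rpow_le {p a b : ℝ} (hp1 : 1 ≤ p) (hp2 : p ≤ 2) (hb : 0 ≤ b) (hab : b ≤ a) :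
    a ^ p - b ^ p ≤ 2 * (1 + a) * (a - b) := by
  rcases (hb.trans hab).eq_or_lt with rfl | ha
  · obtain rfl : b = 0 := le_antisymm hab hb
    simp
  have hba : 0 ≤ b / a := by positivity
  have bern := one_add_mul_self_le_rpow_one_add (show -1 ≤ b / a - 1 by linarith) hp1
  rw [add_sub_cancel, Real.div_rpow hb ha.le, le_div_iff₀ (Real.rpow_pos_of_pos ha p)] at bern
  have hpow : a ^ p = a ^ (p - 1) * a := by
    rw [Real.rpow_sub_one ha.ne', div_mul_cancel₀ _ ha.ne']
  have h1 : a ^ (p - 1) ≤ 1 + a := by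
    rcases le_total a 1 with h | h
    · have := Real.rpow_le_one ha.le h (show 0 ≤ p - 1 by linarith)
      linarith
    · have := Real.rpow_le_rpow_of_exponent_le h (show p - 1 ≤ 1 by linarith)
      rw [Real.rpow_one] at this
      linarith
  have h0 : 0 ≤ a ^ (p - 1) := Real.rpow_nonneg ha.le _
  have e : (1 + p * (b / a - 1)) * a ^ p = a ^ p - p * a ^ (p - 1) * (a - b) := by
    rw [hpow]
    field_simp
    ring
  rw [e] at bern
  calc a ^ p - b ^ p ≤ p * a ^ (p - 1) * (a - b) := by linarith
    _ ≤ 2 * (1 + a) * (a - b) := by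
      have : 0 ≤ a - b := by linarith
      gcongr

lemma abs_max_rpow_sub_max_rpow_le {p : ℝ} (hp1 : 1 ≤ p) (hp2 : p ≤ 2) (a b : ℝ) :
    |max a 0 ^ p - max b 0 ^ p| ≤ 2 * (1 + |a| + |b|) * |a - b| := by
  wlog hab : b ≤ a generalizing a b
  · rw [abs_sub_comm, abs_sub_comm a b]
    linarith [this b a (le_of_not_ge hab)]
  have hmono : max b 0 ≤ max a 0 := max_le_max_right 0 hab
  have h1 := Real.rpow_sub_rpow_le hp1 hp2 (le_max_right b 0) hmono
  have h2 : max b 0 ^ p ≤ max a 0 ^ p :=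
    Real.rpow_le_rpow (le_max_right _ _) hmono (by linarith)
  have h3 : max a 0 ≤ |a| := max_le (le_abs_self a) (abs_nonneg a)
  have h4 : max a 0 - max b 0 ≤ a - b := by
    have := max_sub_max_le_max a 0 b 0
    rwa [sub_zero, max_eq_left (sub_nonneg.mpr hab)] at this
  rw [abs_of_nonneg (by linarith), abs_of_nonneg (sub_nonneg.mpr hab)]
  refine h1.trans ?_
  have h5 : 0 ≤ max a 0 - max b 0 := by linarith
  have h6 : max a 0 ≤ |a| + |b| := by linarith [abs_nonneg b]
  rw [add_assoc]
  gcongr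

lemma LocLip.of_lipschitz {α : Type*} [NormedAddCommGroup α] {φ : α → ℝ} {K : ℝ}
    (hφ : ∀ x y, |φ x - φ y| ≤ K * ‖x - y‖) : LocLip φ := by
  refine ⟨|K| + 1, by positivity, 0, fun x y => (hφ x y).trans ?_⟩
  have : K ≤ (|K| + 1) * (1 + ‖x‖ ^ 0 + ‖y‖ ^ 0) := by
    rw [pow_zero, pow_zero]
    linarith [le_abs_self K, abs_nonneg K]
  gcongr

lemma LocLip.comp_lipschitz {α : Type*} [NormedAddCommGroup α] {f : ℝ → ℝ} (hf : LocLip f)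
    {L : α → ℝ} {K : ℝ} (hK : 1 ≤ K) (h0 : L 0 = 0)
    (hL : ∀ x y, |L x - L y| ≤ K * ‖x - y‖) : LocLip (fun x => f (L x)) := by
  obtain ⟨C, hC, m, h⟩ := hf
  have hbound : ∀ x, ‖L x‖ ^ m ≤ K ^ m * ‖x‖ ^ m := fun x => by
    have := hL x 0
    rw [h0, sub_zero, sub_zero] at this
    rw [← mul_pow]
    exact pow_le_pow_left₀ (norm_nonneg _) this m
  refine ⟨C * K ^ m * K, by positivity, m, fun x y => ?_⟩
  have hKm : 1 ≤ K ^ m := one_le_pow₀ hK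
  calc |f (L x) - f (L y)| ≤ C * (1 + ‖L x‖ ^ m + ‖L y‖ ^ m) * ‖L x - L y‖ := h _ _
    _ ≤ C * (K ^ m + K ^ m * ‖x‖ ^ m + K ^ m * ‖y‖ ^ m) * (K * ‖x - y‖) := by
      gcongr
      · exact hbound x
      · exact hbound y
      · exact hL x y
    _ = _ := by ring

lemma locLip_max_rpow {p : ℝ} (hp1 : 1 ≤ p) (hp2 : p ≤ 2) :
    LocLip (fun t : ℝ => max t 0 ^ p) :=
  ⟨2, two_pos, 1, fun x y => by
    simpa only [pow_one, Real.norm_eq_abs] using abs_max_rpow_sub_max_rpow_le hp1 hp2 x y⟩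

lemma abs_apply_sub_apply_le_norm_sub {k : ℕ} (x y : Fin k → ℝ) (i : Fin k) :
    |x i - y i| ≤ ‖x - y‖ :=
  norm_le_pi_norm (x - y) i

namespace SubLinExp

variable {Ω : Type*} (S : SubLinExp Ω)

lemma comp_mem_one {Y : Ω → ℝ} (hY : Y ∈ S.H) {f : ℝ → ℝ} (hf : LocLip f) :
    (fun ω => f (Y ω)) ∈ S.H :=
  S.comp_mem 1 (fun _ => Y) (fun _ => hY) (fun v => f (v 0))
    (hf.comp_lipschitz le_rfl rfl fun x y => by
      rw [one_mul]; exact abs_apply_sub_apply_le_norm_sub x y 0)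

lemma comp_mem_two {Y Z : Ω → ℝ} (hY : Y ∈ S.H) (hZ : Z ∈ S.H) {f : ℝ → ℝ → ℝ}
    (hf : ∀ a b c d, |f a b - f c d| ≤ |a - c| + |b - d|) :
    (fun ω => f (Y ω) (Z ω)) ∈ S.H :=
  S.comp_mem 2 ![Y, Z] (by intro i; fin_cases i <;> assumption) (fun v => f (v 0) (v 1))
    (LocLip.of_lipschitz (K := 2) fun x y => by
      linarith [hf (x 0) (x 1) (y 0) (y 1), abs_apply_sub_apply_le_norm_sub x y 0,
        abs_apply_sub_apply_le_norm_sub x y 1])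

lemma add_mem {Y Z : Ω → ℝ} (hY : Y ∈ S.H) (hZ : Z ∈ S.H) : (fun ω => Y ω + Z ω) ∈ S.H :=
  S.comp_mem_two hY hZ (f := fun a b => a + b) fun a b c d => by
    rw [add_sub_add_comm]; exact abs_add_le _ _

lemma sub_mem {Y Z : Ω → ℝ} (hY : Y ∈ S.H) (hZ : Z ∈ S.H) : (fun ω => Y ω - Z ω) ∈ S.H :=
  S.comp_mem_two hY hZ (f := fun a b => a - b) fun a b c d => by
    rw [sub_sub_sub_comm]; exact abs_sub _ _

lemma max_mem {Y Z : Ω → ℝ} (hY : Y ∈ S.H) (hZ : Z ∈ S.H) : (fun ω => max (Y ω) (Z ω)) ∈ S.H :=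
  S.comp_mem_two hY hZ (f := fun a b => max a b) fun a b c d =>
    (abs_max_sub_max_le_max a b c d).trans
      (max_le_add_of_nonneg (abs_nonneg _) (abs_nonneg _))

lemma const_mul_mem (c : ℝ) {Y : Ω → ℝ} (hY : Y ∈ S.H) : (fun ω => c * Y ω) ∈ S.H :=
  S.comp_mem_one hY (f := fun a => c * a) (LocLip.of_lipschitz (K := |c|) fun x y => by
    rw [← mul_sub, abs_mul, Real.norm_eq_abs])

lemma abs_mem {Y : Ω → ℝ} (hY : Y ∈ S.H) : (fun ω => |Y ω|) ∈ S.H :=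
  S.comp_mem_one hY (f := fun a => |a|) (LocLip.of_lipschitz (K := 1) fun x y => by
    rw [one_mul]; exact abs_abs_sub_abs_le_abs_sub x y)

lemma sum_mem {ι : Type*} (s : Finset ι) {Y : ι → Ω → ℝ} (hY : ∀ i ∈ s, Y i ∈ S.H) :
    (fun ω => ∑ i ∈ s, Y i ω) ∈ S.H := by
  classical
  induction s using Finset.induction_on with
  | empty => simpa using S.const_mem 0
  | insert a s ha ih =>
    simp only [Finset.sum_insert ha]
    exact S.add_mem (hY a (Finset.mem_insert_self a s))
      (ih fun i hi => hY i (Finset.mem_insert_of_mem hi))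

lemma sup'_mem {ι : Type*} (s : Finset ι) (hs : s.Nonempty) {Y : ι → Ω → ℝ}
    (hY : ∀ i ∈ s, Y i ∈ S.H) : (fun ω => s.sup' hs fun i => Y i ω) ∈ S.H := by
  have : s.sup' hs Y ∈ S.H :=
    Finset.sup'_induction hs Y (p := (· ∈ S.H)) (fun _ h₁ _ h₂ => S.max_mem h₁ h₂) hY
  convert this using 1
  ext ω
  rw [Finset.sup'_apply]

variable {p : ℝ}

lemma max_rpow_mem (hp1 : 1 ≤ p) (hp2 : p ≤ 2) {Y : Ω → ℝ} (hY : Y ∈ S.H) :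
    (fun ω => max (Y ω) 0 ^ p) ∈ S.H :=
  S.comp_mem_one hY (locLip_max_rpow hp1 hp2)

lemma abs_rpow_mem (hp1 : 1 ≤ p) (hp2 : p ≤ 2) {Y : Ω → ℝ} (hY : Y ∈ S.H) :
    (fun ω => |Y ω| ^ p) ∈ S.H := by
  have h := S.max_rpow_mem hp1 hp2 (S.abs_mem hY)
  have e : ∀ ω, max |Y ω| 0 = |Y ω| := fun ω => max_eq_left (abs_nonneg _)
  simpa only [e] using h

lemma abs_rpow_nonneg (hp1 : 1 ≤ p) (hp2 : p ≤ 2) {Y : Ω → ℝ} (hY : Y ∈ S.H) :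
    0 ≤ S.E (fun ω => |Y ω| ^ p) := by
  rw [← S.const 0]
  exact S.mono _ (S.abs_rpow_mem hp1 hp2 hY) _ (S.const_mem 0) fun ω => by positivity

lemma E_max_add_rpow_le (hp1 : 1 ≤ p) (hp2 : p ≤ 2) {Y : Ω → ℝ} (hY : Y ∈ S.H)
    (hmean : S.E Y ≤ 0) {m : ℝ} (hm : 0 ≤ m) :
    S.E (fun ω => max (m + Y ω) 0 ^ p) ≤ m ^ p + S.E (fun ω => |Y ω| ^ p) := by
  obtain ⟨c, hc, h⟩ := Real.max_add_rpow_le hp1 hp2 hm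
  have h1 := S.abs_rpow_mem hp1 hp2 hY
  have h2 := S.add_mem h1 (S.const_mem (m ^ p))
  have h3 := S.const_mul_mem c hY
  have b1 := S.mono _ (S.add_mem h2 h3) _
    (S.max_rpow_mem hp1 hp2 (S.add_mem (S.const_mem m) hY)) fun ω => h (Y ω)
  have b2 := S.subadd _ h2 _ h3
  have b3 := S.subadd _ h1 _ (S.const_mem (m ^ p))
  rw [S.const] at b3
  rw [S.homog c hc _ hY] at b2
  have b4 := mul_nonpos_of_nonneg_of_nonpos hc hmean
  linarith

lemma E_max_add_rpow_sub_le (hp1 : 1 ≤ p) (hp2 : p ≤ 2) {Y : Ω → ℝ} (hY : Y ∈ S.H) (a b : ℝ) :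
    S.E (fun ω => max (a + Y ω) 0 ^ p) - S.E (fun ω => max (b + Y ω) 0 ^ p) ≤
      2 * |a - b| * (1 + |a| + |b| + 2 * S.E (fun ω => |Y ω|)) := by
  have ha := S.max_rpow_mem hp1 hp2 (S.add_mem (S.const_mem a) hY)
  have hb := S.max_rpow_mem hp1 hp2 (S.add_mem (S.const_mem b) hY)
  have h2Y := S.const_mul_mem 2 (S.abs_mem hY)
  have hs := S.add_mem (S.const_mem (1 + |a| + |b|)) h2Y
  have hr := S.const_mul_mem (2 * |a - b|) hs
  have b1 := S.mono _ (S.add_mem hb hr) _ ha fun ω => by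
    have h := (le_abs_self _).trans
      (abs_max_rpow_sub_max_rpow_le hp1 hp2 (a + Y ω) (b + Y ω))
    rw [add_sub_add_right_eq_sub] at h
    have h' : 2 * (1 + |a + Y ω| + |b + Y ω|) * |a - b| ≤
        2 * (1 + (|a| + |Y ω|) + (|b| + |Y ω|)) * |a - b| := by
      gcongr <;> exact abs_add_le _ _
    linarith
  have b2 := S.subadd _ hb _ hr
  rw [S.homog _ (by positivity) _ hs] at b2
  have b3 := S.subadd _ (S.const_mem (1 + |a| + |b|)) _ h2Y
  rw [S.const, S.homog _ zero_le_two _ (S.abs_mem hY)] at b3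
  have b4 := mul_le_mul_of_nonneg_left b3 (show 0 ≤ 2 * |a - b| by positivity)
  linarith

lemma locLip_E_max_add_rpow (hp1 : 1 ≤ p) (hp2 : p ≤ 2) {Y : Ω → ℝ} (hY : Y ∈ S.H) :
    LocLip (fun a : ℝ => S.E (fun ω => max (a + Y ω) 0 ^ p)) := by
  have hE : 0 ≤ S.E (fun ω => |Y ω|) := by
    rw [← S.const 0]
    exact S.mono _ (S.abs_mem hY) _ (S.const_mem 0) fun ω => abs_nonneg _
  refine ⟨2 * (1 + 2 * S.E (fun ω => |Y ω|)), by positivity, 1, fun a b => ?_⟩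
  rw [pow_one, pow_one, Real.norm_eq_abs, Real.norm_eq_abs, Real.norm_eq_abs]
  have key : 2 * |a - b| * (1 + |a| + |b| + 2 * S.E (fun ω => |Y ω|)) ≤
      2 * (1 + 2 * S.E (fun ω => |Y ω|)) * (1 + |a| + |b|) * |a - b| := by
    have : 0 ≤ |a - b| * (S.E (fun ω => |Y ω|) * (|a| + |b|)) := by positivity
    linarith
  refine abs_sub_le_iff.mpr ⟨(S.E_max_add_rpow_sub_le hp1 hp2 hY a b).trans key, ?_⟩
  have h := S.E_max_add_rpow_sub_le hp1 hp2 hY b a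
  rw [abs_sub_comm b a] at h
  linarith

end SubLinExp

/-- The random walk with steps `y 0, y 1, …` reflected at zero. -/
def reflectedWalk (y : ℕ → ℝ) : ℕ → ℝ
  | 0 => 0
  | k + 1 => max (reflectedWalk y k + y k) 0

lemma reflectedWalk_nonneg (y : ℕ → ℝ) (k : ℕ) : 0 ≤ reflectedWalk y k := by
  cases k with
  | zero => exact le_rfl
  | succ k => exact le_max_right _ _

lemma reflectedWalk_congr {y z : ℕ → ℝ} {k : ℕ} (h : ∀ j < k, y j = z j) :
    reflectedWalk y k = reflectedWalk z k := by
  induction k with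
  | zero => rfl
  | succ k ih =>
    rw [reflectedWalk, reflectedWalk, ih fun j hj => h j (hj.trans k.lt_succ_self),
      h k k.lt_succ_self]

lemma abs_reflectedWalk_sub_le {y z : ℕ → ℝ} {d : ℝ} (h : ∀ j, |y j - z j| ≤ d) (k : ℕ) :
    |reflectedWalk y k - reflectedWalk z k| ≤ k * d := by
  induction k with
  | zero => simp [reflectedWalk]
  | succ k ih =>
    have h1 := abs_max_sub_max_le_abs (reflectedWalk y k + y k) (reflectedWalk z k + z k) 0
    rw [add_sub_add_comm] at h1
    have h2 := abs_add_le (reflectedWalk y k - reflectedWalk z k) (y k - z k)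
    rw [reflectedWalk, reflectedWalk]
    push_cast
    linarith [h k]

lemma reflectedWalk_zero (k : ℕ) : reflectedWalk (fun _ => 0) k = 0 := by
  induction k with
  | zero => rfl
  | succ k ih => simp [reflectedWalk, ih]

lemma sum_Icc_sub_sum_Icc_le_reflectedWalk (x : ℕ → ℝ) {k n : ℕ} (hk : k ≤ n) :
    (∑ i ∈ Finset.Icc 1 n, x i) - ∑ i ∈ Finset.Icc 1 k, x i ≤
      reflectedWalk (fun j => x (j + 1)) n := by
  induction n, hk using Nat.le_induction with
  | base => rw [sub_self]; exact reflectedWalk_nonneg _ _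
  | succ n hn ih =>
    rw [Finset.sum_Icc_succ_top (by omega), reflectedWalk]
    exact le_max_of_le_left (by linarith)

lemma locLip_max_reflectedWalk_add_rpow {p : ℝ} (hp1 : 1 ≤ p) (hp2 : p ≤ 2) (k : ℕ) :
    LocLip (fun q : (Fin k → ℝ) × ℝ =>
      max (reflectedWalk (fun j => if h : j < k then q.1 ⟨j, h⟩ else 0) k + q.2) 0 ^ p) := by
  refine (locLip_max_rpow hp1 hp2).comp_lipschitz (K := k + 1) (by simp) ?_ fun x y => ?_
  · simp [reflectedWalk_zero]
  · have h1 : ‖x.1 - y.1‖ ≤ ‖x - y‖ := norm_fst_le (x - y)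
    have h2 : |x.2 - y.2| ≤ ‖x - y‖ := norm_snd_le (x - y)
    have h3 := abs_reflectedWalk_sub_le (d := ‖x - y‖)
      (y := fun j => if h : j < k then x.1 ⟨j, h⟩ else 0)
      (z := fun j => if h : j < k then y.1 ⟨j, h⟩ else 0) (fun j => by
        by_cases h : j < k
        · simpa [h] using (abs_apply_sub_apply_le_norm_sub x.1 y.1 ⟨j, h⟩).trans h1
        · simp [h]) k
    rw [add_sub_add_comm]
    linarith [abs_add_le
      (reflectedWalk (fun j => if h : j < k then x.1 ⟨j, h⟩ else 0) k -
        reflectedWalk (fun j => if h : j < k then y.1 ⟨j, h⟩ else 0) k) (x.2 - y.2)]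

namespace SubLinExp

variable {Ω : Type*} (S : SubLinExp Ω)

lemma reflectedWalk_mem {X : ℕ → Ω → ℝ} {k : ℕ} (hX : ∀ j < k, X j ∈ S.H) :
    (fun ω => reflectedWalk (fun j => X j ω) k) ∈ S.H := by
  induction k with
  | zero => exact S.const_mem 0
  | succ k ih =>
    exact S.max_mem (S.add_mem (ih fun j hj => hX j (hj.trans k.lt_succ_self))
      (hX k k.lt_succ_self)) (S.const_mem 0)

/-- One step of the reflected walk raises the `p`-th moment by at most that of the increment. -/
lemma E_max_reflectedWalk_add_rpow_le {p : ℝ} (hp1 : 1 ≤ p) (hp2 : p ≤ 2) {k : ℕ}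
    {X : ℕ → Ω → ℝ} (hX : ∀ j < k, X j ∈ S.H) {Y : Ω → ℝ} (hY : Y ∈ S.H)
    (hmean : S.E Y ≤ 0) (hindep : IndepVecOf S Y (fun j : Fin k => X j)) :
    S.E (fun ω => max (reflectedWalk (fun j => X j ω) k + Y ω) 0 ^ p) ≤
      S.E (fun ω => reflectedWalk (fun j => X j ω) k ^ p) + S.E (fun ω => |Y ω| ^ p) := by
  have hW := S.reflectedWalk_mem hX
  have hWp : (fun ω => reflectedWalk (fun j => X j ω) k ^ p) ∈ S.H := by
    simpa only [abs_of_nonneg (reflectedWalk_nonneg _ _)] using S.abs_rpow_mem hp1 hp2 hW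
  have key := hindep (fun x y =>
    max (reflectedWalk (fun j => if h : j < k then x ⟨j, h⟩ else 0) k + y) 0 ^ p)
    (locLip_max_reflectedWalk_add_rpow hp1 hp2 k)
  have hext : ∀ ω, reflectedWalk (fun j => if _h : j < k then X j ω else 0) k =
      reflectedWalk (fun j => X j ω) k := fun ω =>
    reflectedWalk_congr fun j hj => dif_pos hj
  simp only [hext] at key
  rw [key]
  have hc := S.const_mem (S.E (fun ω => |Y ω| ^ p))
  have b1 := S.mono _ (S.add_mem hWp hc) _
    (S.comp_mem_one hW (S.locLip_E_max_add_rpow hp1 hp2 hY)) fun ω =>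
      S.E_max_add_rpow_le hp1 hp2 hY hmean (reflectedWalk_nonneg _ _)
  have b2 := S.subadd _ hWp _ hc
  rw [S.const] at b2
  exact b1.trans b2

lemma E_reflectedWalk_rpow_le {p : ℝ} (hp1 : 1 ≤ p) (hp2 : p ≤ 2) {X : ℕ → Ω → ℝ} {n : ℕ}
    (hX : ∀ k, 1 ≤ k → k ≤ n → X k ∈ S.H) (hindep : IndepUpTo1 S X n)
    (hmean : ∀ k, 1 ≤ k → k ≤ n → S.E (X k) ≤ 0) {k : ℕ} (hk : k ≤ n) :
    S.E (fun ω => reflectedWalk (fun j => X (j + 1) ω) k ^ p) ≤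
      ∑ i ∈ Finset.Icc 1 k, S.E (fun ω => |X i ω| ^ p) := by
  induction k with
  | zero => simp [reflectedWalk, Real.zero_rpow (show p ≠ 0 by linarith), S.const]
  | succ k ih =>
    have hY := hX (k + 1) (by omega) hk
    have hm := hmean (k + 1) (by omega) hk
    rw [Finset.sum_Icc_succ_top (by omega)]
    simp only [reflectedWalk]
    rcases Nat.eq_zero_or_pos k with rfl | hpos
    · have h := S.E_max_add_rpow_le hp1 hp2 hY hm le_rfl
      rw [Real.zero_rpow (by linarith)] at h
      simpa [reflectedWalk] using h
    · have h := S.E_max_reflectedWalk_add_rpow_le hp1 hp2 (X := fun j => X (j + 1))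
        (fun j hj => hX (j + 1) (by omega) (by omega)) hY hm (hindep k hpos hk)
      exact h.trans (add_le_add_left (ih (by omega)) _)

end SubLinExp

/-- Maximal inequality of Zhang: for independent `X₁,…,Xₙ` with `Ê(Xₖ) ≤ 0` and `1 ≤ p ≤ 2`,
`Ê(|max_{1≤k≤n}(Sₙ − Sₖ)|^p) ≤ 2^{2−p} Σ_{k=1}^n Ê(|Xₖ|^p)`, and in particular
`Ê((Sₙ⁺)^p) ≤ 2^{2−p} Σ_{k=1}^n Ê(|Xₖ|^p)`. -/
theorem zhang_maximal_inequality {Ω : Type*} (S : SubLinExp Ω)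
    (n : ℕ) (hn : 1 ≤ n) (X : ℕ → Ω → ℝ)
    (hX : ∀ k, 1 ≤ k → k ≤ n → X k ∈ S.H)
    (hindep : IndepUpTo1 S X n)
    (p : ℝ) (hp1 : 1 ≤ p) (hp2 : p ≤ 2)
    (hmean : ∀ k, 1 ≤ k → k ≤ n → S.E (X k) ≤ 0) :
    S.E (fun ω => |(Finset.Icc 1 n).sup' (Finset.nonempty_Icc.mpr hn)
          (fun k => (∑ i ∈ Finset.Icc 1 n, X i ω) - ∑ i ∈ Finset.Icc 1 k, X i ω)| ^ p)
        ≤ (2 : ℝ) ^ (2 - p) * ∑ k ∈ Finset.Icc 1 n, S.E (fun ω => |X k ω| ^ p) ∧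
      S.E (fun ω => (max (∑ i ∈ Finset.Icc 1 n, X i ω) 0) ^ p)
        ≤ (2 : ℝ) ^ (2 - p) * ∑ k ∈ Finset.Icc 1 n, S.E (fun ω => |X k ω| ^ p) := by
  have hsum : ∀ k ≤ n, (fun ω => ∑ i ∈ Finset.Icc 1 k, X i ω) ∈ S.H := fun k hk =>
    S.sum_mem _ fun i hi => hX i (Finset.mem_Icc.mp hi).1 ((Finset.mem_Icc.mp hi).2.trans hk)
  have hWmem := S.reflectedWalk_mem (X := fun j => X (j + 1)) (k := n)
    fun j hj => hX (j + 1) (by omega) (by omega)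
  have hWp := S.abs_rpow_mem hp1 hp2 hWmem
  simp only [abs_of_nonneg (reflectedWalk_nonneg _ _)] at hWp
  have hbound : S.E (fun ω => reflectedWalk (fun j => X (j + 1) ω) n ^ p) ≤
      (2 : ℝ) ^ (2 - p) * ∑ k ∈ Finset.Icc 1 n, S.E (fun ω => |X k ω| ^ p) := by
    refine (S.E_reflectedWalk_rpow_le hp1 hp2 hX hindep hmean le_rfl).trans ?_
    refine le_mul_of_one_le_left (Finset.sum_nonneg fun i hi => S.abs_rpow_nonneg hp1 hp2
      (hX i (Finset.mem_Icc.mp hi).1 (Finset.mem_Icc.mp hi).2)) ?_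
    exact Real.one_le_rpow one_le_two (by linarith)
  refine ⟨(S.mono _ hWp _ ?_ fun ω => ?_).trans hbound,
    (S.mono _ hWp _ (S.max_rpow_mem hp1 hp2 (hsum n le_rfl)) fun ω => ?_).trans hbound⟩
  · exact S.abs_rpow_mem hp1 hp2 (S.sup'_mem _ _ fun k hk =>
      S.sub_mem (hsum n le_rfl) (hsum k (Finset.mem_Icc.mp hk).2))
  · refine Real.rpow_le_rpow (abs_nonneg _) ?_ (by linarith)
    rw [abs_of_nonneg]
    · exact Finset.sup'_le _ _ fun k hk =>
        sum_Icc_sub_sum_Icc_le_reflectedWalk (fun i => X i ω) (Finset.mem_Icc.mp hk).2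
    · refine Finset.le_sup'_of_le _ (Finset.mem_Icc.mpr ⟨hn, le_rfl⟩) ?_
      rw [sub_self]
  · refine Real.rpow_le_rpow (le_max_right _ _) (max_le ?_ (reflectedWalk_nonneg _ _))
      (by linarith)
    simpa using sum_Icc_sub_sum_Icc_le_reflectedWalk (fun i => X i ω) n.zero_le
end

section
/- (Rosenthal-type maximal inequality.) Let X₁,…,Xₙ be independent random variables in a sublinear expectation space (Ω, H, Ê) with Ê(X_i) = ε̂(X_i) = 0 for each i, and let Sₖ = Σ_{i=1}^k X_i. Then for every p ≥ 2 there is a positive constant C_p depending only on p such that Ê(max_{1≤k≤n} |Sₖ|^p) ≤ C_p { Σ_{k=1}^n Ê(|Xₖ|^p) + (Σ_{k=1}^n Ê(|Xₖ|²))^{p/2} }. -/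
open Filter MeasureTheory Set

namespace LocLip

variable {α β : Type*} [NormedAddCommGroup α] [NormedAddCommGroup β]

/-- Local Lipschitz functions, with the polynomial weight written as a single power. -/
theorem iff_pow {φ : α → ℝ} :
    LocLip φ ↔ ∃ C : ℝ, 0 ≤ C ∧ ∃ m : ℕ, ∀ x y : α,
      |φ x - φ y| ≤ C * (1 + ‖x‖ + ‖y‖) ^ m * ‖x - y‖ := by
  constructor
  · rintro ⟨C, hC, m, h⟩
    refine ⟨C * 3, by positivity, m, fun x y => (h x y).trans ?_⟩
    have hx := norm_nonneg x
    have hy := norm_nonneg y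
    have h1 : (1 : ℝ) ≤ (1 + ‖x‖ + ‖y‖) ^ m := one_le_pow₀ (by linarith)
    have h2 : ‖x‖ ^ m ≤ (1 + ‖x‖ + ‖y‖) ^ m := pow_le_pow_left₀ hx (by linarith) m
    have h3 : ‖y‖ ^ m ≤ (1 + ‖x‖ + ‖y‖) ^ m := pow_le_pow_left₀ hy (by linarith) m
    rw [mul_assoc C 3]
    gcongr
    linarith
  · rintro ⟨C, hC, m, h⟩
    refine ⟨C * 3 ^ m + 1, by positivity, m, fun x y => (h x y).trans ?_⟩
    have hx := norm_nonneg x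
    have hy := norm_nonneg y
    have key : (1 + ‖x‖ + ‖y‖) ^ m ≤ 3 ^ m * (1 + ‖x‖ ^ m + ‖y‖ ^ m) := by
      have hxm : 0 ≤ ‖x‖ ^ m := by positivity
      have hym : 0 ≤ ‖y‖ ^ m := by positivity
      have : (max 1 (max ‖x‖ ‖y‖)) ^ m ≤ 1 + ‖x‖ ^ m + ‖y‖ ^ m := by
        rcases max_choice 1 (max ‖x‖ ‖y‖) with h | h
        · rw [h, one_pow]; linarith
        · rw [h]
          rcases max_choice ‖x‖ ‖y‖ with h | h <;> rw [h] <;> linarith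
      calc (1 + ‖x‖ + ‖y‖) ^ m ≤ (3 * max 1 (max ‖x‖ ‖y‖)) ^ m := by
            refine pow_le_pow_left₀ (by positivity) ?_ m
            have h1 := le_max_left 1 (max ‖x‖ ‖y‖)
            have h2 := (le_max_left ‖x‖ ‖y‖).trans (le_max_right 1 (max ‖x‖ ‖y‖))
            have h3 := (le_max_right ‖x‖ ‖y‖).trans (le_max_right 1 (max ‖x‖ ‖y‖))
            linarith
        _ = 3 ^ m * (max 1 (max ‖x‖ ‖y‖)) ^ m := mul_pow _ _ _
        _ ≤ _ := by gcongr
    have hs : 0 ≤ 1 + ‖x‖ ^ m + ‖y‖ ^ m := by positivity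
    refine mul_le_mul_of_nonneg_right ?_ (norm_nonneg _)
    nlinarith [mul_le_mul_of_nonneg_left key hC]

/-- Local Lipschitz functions grow at most polynomially. -/
theorem exists_abs_le {φ : α → ℝ} (h : LocLip φ) :
    ∃ C : ℝ, 0 ≤ C ∧ ∃ m : ℕ, ∀ x : α, |φ x| ≤ C * (1 + ‖x‖) ^ m := by
  obtain ⟨C, hC, m, h⟩ := iff_pow.1 h
  refine ⟨C + |φ 0|, by positivity, m + 1, fun x => ?_⟩
  have h0 := h x 0
  simp only [norm_zero, add_zero, sub_zero] at h0
  have h1 : (1 : ℝ) ≤ (1 + ‖x‖) ^ (m + 1) := one_le_pow₀ (by linarith [norm_nonneg x])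
  have h2 : (1 + ‖x‖) ^ m * ‖x‖ ≤ (1 + ‖x‖) ^ (m + 1) := by
    rw [pow_succ]; gcongr; linarith
  have h3 : |φ x| ≤ |φ x - φ 0| + |φ 0| := by
    simpa using abs_add_le (φ x - φ 0) (φ 0)
  nlinarith [mul_le_mul_of_nonneg_left h2 hC, mul_le_mul_of_nonneg_left h1 (abs_nonneg (φ 0))]

theorem of_lipschitz_s4 {φ : α → ℝ} (K : ℝ) (hK : 0 ≤ K) (h : ∀ x y, |φ x - φ y| ≤ K * ‖x - y‖) :
    LocLip φ :=
  iff_pow.2 ⟨K, hK, 0, fun x y => by simpa using h x y⟩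

theorem const (c : ℝ) : LocLip (fun _ : α => c) :=
  of_lipschitz_s4 0 le_rfl fun x y => by simp

theorem id : LocLip (fun r : ℝ => r) :=
  of_lipschitz_s4 1 zero_le_one fun x y => by simp [Real.norm_eq_abs]

/-- Two local Lipschitz functions satisfy their estimates with a common constant and exponent. -/
theorem exists_common {φ ψ : α → ℝ} (hφ : LocLip φ) (hψ : LocLip ψ) :
    ∃ C : ℝ, 0 ≤ C ∧ ∃ m : ℕ, ∀ x y : α,
      |φ x - φ y| ≤ C * (1 + ‖x‖ + ‖y‖) ^ m * ‖x - y‖ ∧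
      |ψ x - ψ y| ≤ C * (1 + ‖x‖ + ‖y‖) ^ m * ‖x - y‖ := by
  obtain ⟨C, hC, m, h⟩ := iff_pow.1 hφ
  obtain ⟨D, hD, k, h'⟩ := iff_pow.1 hψ
  refine ⟨max C D, le_max_of_le_left hC, max m k, fun x y =>
    ⟨(h x y).trans ?_, (h' x y).trans ?_⟩⟩
  · gcongr
    · exact le_max_left _ _
    · linarith [norm_nonneg x, norm_nonneg y]
    · exact le_max_left _ _
  · gcongr
    · exact le_max_right _ _
    · linarith [norm_nonneg x, norm_nonneg y]
    · exact le_max_right _ _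

theorem add {φ ψ : α → ℝ} (hφ : LocLip φ) (hψ : LocLip ψ) : LocLip (fun x => φ x + ψ x) := by
  obtain ⟨C, hC, m, h⟩ := exists_common hφ hψ
  refine iff_pow.2 ⟨2 * C, by positivity, m, fun x y => ?_⟩
  have := abs_add_le (φ x - φ y) (ψ x - ψ y)
  rw [show φ x + ψ x - (φ y + ψ y) = (φ x - φ y) + (ψ x - ψ y) by ring]
  linarith [(h x y).1, (h x y).2]

theorem sup {φ ψ : α → ℝ} (hφ : LocLip φ) (hψ : LocLip ψ) :
    LocLip (fun x => max (φ x) (ψ x)) := by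
  obtain ⟨C, hC, m, h⟩ := exists_common hφ hψ
  exact iff_pow.2 ⟨C, hC, m, fun x y =>
    (abs_max_sub_max_le_max _ _ _ _).trans (max_le (h x y).1 (h x y).2)⟩

/-- Composition with a local Lipschitz function of one real variable. -/
theorem comp {f : ℝ → ℝ} {φ : α → ℝ} (hf : LocLip f) (hφ : LocLip φ) :
    LocLip (fun x => f (φ x)) := by
  obtain ⟨A, hA, k, hb⟩ := hφ.exists_abs_le
  obtain ⟨C, hC, m, h⟩ := iff_pow.1 hφ
  obtain ⟨D, hD, l, h'⟩ := iff_pow.1 hf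
  refine iff_pow.2 ⟨D * (1 + 2 * A) ^ l * C, by positivity, k * l + m, fun x y => ?_⟩
  refine (h' _ _).trans ?_
  have hx := norm_nonneg x
  have hy := norm_nonneg y
  have hw : 1 + ‖φ x‖ + ‖φ y‖ ≤ (1 + 2 * A) * (1 + ‖x‖ + ‖y‖) ^ k := by
    have h1 : (1 : ℝ) ≤ (1 + ‖x‖ + ‖y‖) ^ k := one_le_pow₀ (by linarith)
    have h2 : A * (1 + ‖x‖) ^ k ≤ A * (1 + ‖x‖ + ‖y‖) ^ k :=
      mul_le_mul_of_nonneg_left (pow_le_pow_left₀ (by linarith) (by linarith) k) hA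
    have h3 : A * (1 + ‖y‖) ^ k ≤ A * (1 + ‖x‖ + ‖y‖) ^ k :=
      mul_le_mul_of_nonneg_left (pow_le_pow_left₀ (by linarith) (by linarith) k) hA
    simp only [Real.norm_eq_abs]
    linarith [hb x, hb y]
  calc D * (1 + ‖φ x‖ + ‖φ y‖) ^ l * ‖φ x - φ y‖
      ≤ D * ((1 + 2 * A) * (1 + ‖x‖ + ‖y‖) ^ k) ^ l * (C * (1 + ‖x‖ + ‖y‖) ^ m * ‖x - y‖) := by
        gcongr
        exact h x y
    _ = _ := by rw [mul_pow, ← pow_mul, pow_add]; ring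

theorem const_mul {φ : α → ℝ} (c : ℝ) (hφ : LocLip φ) : LocLip (fun x => c * φ x) :=
  comp (f := fun r => c * r) (of_lipschitz_s4 |c| (abs_nonneg c) fun x y => by
    rw [← mul_sub, abs_mul, Real.norm_eq_abs]) hφ

theorem sq : LocLip (fun r : ℝ => r ^ 2) :=
  iff_pow.2 ⟨1, zero_le_one, 1, fun x y => by
    rw [show x ^ 2 - y ^ 2 = (x + y) * (x - y) by ring, abs_mul, one_mul, pow_one]
    simp only [Real.norm_eq_abs]
    gcongr
    linarith [abs_add_le x y]⟩

theorem mul {φ ψ : α → ℝ} (hφ : LocLip φ) (hψ : LocLip ψ) : LocLip (fun x => φ x * ψ x) := by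
  have h := const_mul (1 / 4) ((sq.comp (hφ.add hψ)).add
    (const_mul (-1) (sq.comp (hφ.add (const_mul (-1) hψ)))))
  convert h using 2
  ring

/-- Composition with a map which is 1-Lipschitz and does not increase norms. -/
theorem comp_of_norm_le {φ : β → ℝ} (hφ : LocLip φ) {g : α → β} (h0 : ∀ x, ‖g x‖ ≤ ‖x‖)
    (h1 : ∀ x y, ‖g x - g y‖ ≤ ‖x - y‖) : LocLip (fun x => φ (g x)) := by
  obtain ⟨C, hC, m, h⟩ := iff_pow.1 hφ
  refine iff_pow.2 ⟨C, hC, m, fun x y => (h _ _).trans ?_⟩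
  gcongr <;> first | exact h0 _ | exact h1 _ _

theorem comp_fst {φ : α → ℝ} (hφ : LocLip φ) : LocLip (fun q : α × β => φ q.1) :=
  hφ.comp_of_norm_le (fun q => norm_fst_le q) (fun x y => norm_fst_le (x - y))

theorem comp_snd {φ : β → ℝ} (hφ : LocLip φ) : LocLip (fun q : α × β => φ q.2) :=
  hφ.comp_of_norm_le (fun q => norm_snd_le q) (fun x y => norm_snd_le (x - y))

end LocLip

/-- The tangent line inequality for `t ↦ t ^ q`. -/
theorem rpow_tangent_le {q a b : ℝ} (hq : 1 ≤ q) (ha : 0 ≤ a) (hb : 0 ≤ b) :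
    b ^ q + q * b ^ (q - 1) * (a - b) ≤ a ^ q := by
  rcases hb.eq_or_lt with rfl | hb
  · rcases hq.eq_or_lt with rfl | hq
    · simp
    · rw [Real.zero_rpow (by linarith), Real.zero_rpow (by linarith)]
      simpa using Real.rpow_nonneg ha q
  · have h := one_add_mul_self_le_rpow_one_add (s := a / b - 1)
      (by linarith [div_nonneg ha hb.le]) hq
    rw [add_sub_cancel, Real.div_rpow ha hb.le, le_div_iff₀ (by positivity)] at h
    refine le_trans (le_of_eq ?_) h
    rw [Real.rpow_sub_one hb.ne']
    field_simp

theorem abs_rpow_sub_rpow_le {q a b : ℝ} (hq : 1 ≤ q) (ha : 0 ≤ a) (hb : 0 ≤ b) :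
    |a ^ q - b ^ q| ≤ q * max a b ^ (q - 1) * |a - b| := by
  wlog hab : b ≤ a generalizing a b
  · rw [abs_sub_comm, max_comm, abs_sub_comm a]
    exact this hb ha (le_of_not_ge hab)
  have h := rpow_tangent_le hq hb ha
  rw [max_eq_left hab, abs_of_nonneg (sub_nonneg.2 hab),
    abs_of_nonneg (sub_nonneg.2 (Real.rpow_le_rpow hb hab (by linarith)))]
  linarith

theorem locLip_abs_rpow {q : ℝ} (hq : 1 ≤ q) : LocLip (fun r : ℝ => |r| ^ q) := by
  refine LocLip.iff_pow.2 ⟨q, by linarith, ⌈q⌉₊, fun x y => ?_⟩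
  refine (abs_rpow_sub_rpow_le hq (abs_nonneg x) (abs_nonneg y)).trans ?_
  have hx := abs_nonneg x
  have hy := abs_nonneg y
  simp only [Real.norm_eq_abs]
  refine mul_le_mul (mul_le_mul_of_nonneg_left ?_ (by linarith)) (abs_abs_sub_abs_le x y)
    (abs_nonneg _) (by positivity)
  · calc max |x| |y| ^ (q - 1) ≤ (1 + |x| + |y|) ^ (q - 1) :=
          Real.rpow_le_rpow (le_max_of_le_left hx) (max_le (by linarith) (by linarith))
            (by linarith)
      _ ≤ (1 + |x| + |y|) ^ (⌈q⌉₊ : ℝ) :=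
          Real.rpow_le_rpow_of_exponent_le (by linarith) (by linarith [Nat.le_ceil q])
      _ = _ := Real.rpow_natCast _ _

/-- The odd power function `s ↦ |s| ^ q * sign s`. -/
noncomputable def oddPow (q s : ℝ) : ℝ := |max s 0| ^ q - |max (-s) 0| ^ q

theorem locLip_oddPow {q : ℝ} (hq : 1 ≤ q) : LocLip (oddPow q) := by
  have h := ((locLip_abs_rpow hq).comp (LocLip.id.sup (.const 0))).add
    (((locLip_abs_rpow hq).comp ((LocLip.id.const_mul (-1)).sup (.const 0))).const_mul (-1))
  convert h using 2
  simp [oddPow, sub_eq_add_neg]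

theorem oddPow_of_nonneg {q s : ℝ} (hq : 0 < q) (hs : 0 ≤ s) : oddPow q s = s ^ q := by
  simp [oddPow, hs, abs_of_nonneg hs, Real.zero_rpow hq.ne']

theorem oddPow_neg (q s : ℝ) : oddPow q (-s) = -oddPow q s := by
  simp [oddPow]

/-- A second order expansion of `|s + x| ^ p`. -/
theorem abs_add_rpow_le {p : ℝ} (hp : 2 ≤ p) (s x : ℝ) :
    |s + x| ^ p ≤ |s| ^ p + p * oddPow (p - 1) s * x
      + (p * (p - 1) * 2 ^ p + 2 ^ p + p) * (|s| ^ (p - 2) * x ^ 2 + |x| ^ p) := by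
  wlog hs : 0 ≤ s generalizing s x
  · have h := this (-s) (-x) (by linarith)
    rw [oddPow_neg, ← neg_add, abs_neg, abs_neg, abs_neg, neg_sq] at h
    linarith
  rw [oddPow_of_nonneg (by linarith) hs, abs_of_nonneg hs]
  have h2p : (0 : ℝ) < 2 ^ p := by positivity
  have hsp : 0 ≤ s ^ p := by positivity
  have hA : 0 ≤ s ^ (p - 2) * x ^ 2 := by positivity
  have hB : 0 ≤ |x| ^ p := by positivity
  have hpp : 0 ≤ p * (p - 1) * 2 ^ p := by
    have : 0 ≤ p - 1 := by linarith
    positivity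
  rcases le_total s |x| with hsx | hsx
  · have h1 : |s + x| ^ p ≤ 2 ^ p * |x| ^ p := by
      rw [← Real.mul_rpow zero_le_two (abs_nonneg x)]
      refine Real.rpow_le_rpow (abs_nonneg _) ?_ (by linarith)
      have := abs_add_le s x
      rw [abs_of_nonneg hs] at this
      linarith
    have h2 : -(s ^ (p - 1) * x) ≤ |x| ^ p := by
      calc -(s ^ (p - 1) * x) = s ^ (p - 1) * (-x) := by ring
        _ ≤ |x| ^ (p - 1) * |x| := by
          have hp1 : 0 ≤ p - 1 := by linarith
          exact (mul_le_mul_of_nonneg_left (neg_le_abs x) (by positivity)).trans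
            (mul_le_mul_of_nonneg_right (Real.rpow_le_rpow hs hsx hp1) (abs_nonneg x))
        _ = |x| ^ p := by
          rw [← Real.rpow_add_one' (abs_nonneg x) (by linarith), sub_add_cancel]
    nlinarith [mul_nonneg hpp hA, mul_nonneg hpp hB, mul_nonneg h2p.le hA]
  · have hsx0 : 0 ≤ s + x := by linarith [neg_abs_le x]
    rw [abs_of_nonneg hsx0]
    have h1 := rpow_tangent_le (q := p) (by linarith) hs hsx0
    have h2 := abs_rpow_sub_rpow_le (q := p - 1) (by linarith) hsx0 hs
    rw [add_sub_cancel_left, show p - 1 - 1 = p - 2 by ring] at h2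
    have h3 : max (s + x) s ^ (p - 2) ≤ 2 ^ p * s ^ (p - 2) := by
      calc max (s + x) s ^ (p - 2) ≤ (2 * s) ^ (p - 2) :=
            Real.rpow_le_rpow (le_max_of_le_right hs)
              (max_le (by linarith [le_abs_self x]) (by linarith)) (by linarith)
        _ = 2 ^ (p - 2) * s ^ (p - 2) := Real.mul_rpow zero_le_two hs
        _ ≤ _ := by
          gcongr
          · norm_num
          · linarith
    have h4 : ((s + x) ^ (p - 1) - s ^ (p - 1)) * x ≤ (p - 1) * 2 ^ p * (s ^ (p - 2) * x ^ 2) := by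
      calc ((s + x) ^ (p - 1) - s ^ (p - 1)) * x
          ≤ |(s + x) ^ (p - 1) - s ^ (p - 1)| * |x| := by rw [← abs_mul]; exact le_abs_self _
        _ ≤ ((p - 1) * (2 ^ p * s ^ (p - 2)) * |x|) * |x| := by
          refine mul_le_mul_of_nonneg_right (h2.trans ?_) (abs_nonneg x)
          gcongr
          linarith
        _ = (p - 1) * 2 ^ p * (s ^ (p - 2) * |x| ^ 2) := by ring
        _ = _ := by rw [sq_abs]
    nlinarith [mul_nonneg hpp hB, mul_nonneg h2p.le hA, mul_nonneg h2p.le hB,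
      mul_le_mul_of_nonneg_left h4 (by linarith : (0 : ℝ) ≤ p)]

theorem abs_rpow_sub_two_le {p b : ℝ} (hp : 2 ≤ p) (hb : 0 < b) (s : ℝ) :
    |s| ^ (p - 2) ≤ |s| ^ p / b + b ^ (p / 2 - 1) := by
  rcases le_total b (s ^ 2) with h | h
  · have : |s| ^ (p - 2) ≤ |s| ^ p / b := by
      rw [le_div_iff₀ hb]
      calc |s| ^ (p - 2) * b ≤ |s| ^ (p - 2) * |s| ^ 2 := by rw [sq_abs]; gcongr
        _ = |s| ^ p := by
          rw [← Real.rpow_natCast |s| 2, ← Real.rpow_add' (abs_nonneg s)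
            (by push_cast; linarith)]
          norm_num
    linarith [Real.rpow_nonneg hb.le (p / 2 - 1)]
  · have : |s| ^ (p - 2) ≤ b ^ (p / 2 - 1) := by
      calc |s| ^ (p - 2) = (|s| ^ 2) ^ (p / 2 - 1) := by
            rw [← Real.rpow_natCast |s| 2, ← Real.rpow_mul (abs_nonneg s)]
            congr 1
            push_cast
            ring
        _ ≤ _ := Real.rpow_le_rpow (by positivity) (by rwa [sq_abs]) (by linarith)
    have : 0 ≤ |s| ^ p / b := by positivity
    linarith

/-- The pathwise form of Doob's maximal inequality, one step. -/
theorem doob_step {p m : ℝ} (hp : 2 ≤ p) (hm : 0 ≤ m) (y : ℝ) :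
    |max m y| ^ p - 2 * |max m y| ^ (p - 1) * y ≤ |m| ^ p - 2 * |m| ^ (p - 1) * y := by
  rcases le_total y m with h | h
  · rw [max_eq_left h]
  · have hy := hm.trans h
    rw [max_eq_right h, abs_of_nonneg hm, abs_of_nonneg hy]
    have e1 : ∀ t : ℝ, 0 ≤ t → t ^ (p - 1) = t ^ (p - 2) * t := fun t ht => by
      rw [← Real.rpow_add_one' ht (by linarith)]; congr 1; ring
    have e2 : ∀ t : ℝ, 0 ≤ t → t ^ p = t ^ (p - 1) * t := fun t ht => by
      rw [← Real.rpow_add_one' ht (by linarith), sub_add_cancel]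
    have h3 : m ^ (p - 2) ≤ y ^ (p - 2) := Real.rpow_le_rpow hm h (by linarith)
    rw [e2 m hm, e2 y hy, e1 m hm, e1 y hy]
    nlinarith [mul_nonneg (Real.rpow_nonneg hm (p - 2)) (sq_nonneg (y - m)),
      mul_le_mul_of_nonneg_right h3 (sq_nonneg y)]

/-- The potential controlling both the running maximum `m` and the current value `y`. -/
noncomputable def doobPotential (p m y : ℝ) : ℝ :=
  |m| ^ p - 2 * |m| ^ (p - 1) * y + (4 ^ p + 1) * |y| ^ p

theorem add_le_doobPotential {p : ℝ} (hp : 2 ≤ p) (m y : ℝ) :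
    |m| ^ p / 2 + |y| ^ p ≤ doobPotential p m y := by
  have key : 2 * |m| ^ (p - 1) * y ≤ |m| ^ p / 2 + 4 ^ p * |y| ^ p := by
    have e2 : ∀ t : ℝ, 0 ≤ t → t ^ p = t ^ (p - 1) * t := fun t ht => by
      rw [← Real.rpow_add_one' ht (by linarith), sub_add_cancel]
    have hy := abs_nonneg y
    have hm' := abs_nonneg m
    have h1 : 2 * |m| ^ (p - 1) * y ≤ 2 * |m| ^ (p - 1) * |y| := by
      gcongr; exact le_abs_self y
    refine h1.trans ?_
    rcases le_total (4 * |y|) |m| with h | h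
    · have : 0 ≤ (4 : ℝ) ^ p * |y| ^ p := by positivity
      rw [e2 _ hm']
      nlinarith [mul_le_mul_of_nonneg_left h (Real.rpow_nonneg hm' (p - 1))]
    · have h2 : |m| ^ (p - 1) ≤ (4 * |y|) ^ (p - 1) := Real.rpow_le_rpow hm' h (by linarith)
      rw [← Real.mul_rpow (by norm_num) hy, e2 (4 * |y|) (by positivity)]
      have : 0 ≤ |m| ^ p := by positivity
      nlinarith [mul_le_mul_of_nonneg_right h2 hy,
        mul_nonneg (Real.rpow_nonneg (by positivity : 0 ≤ 4 * |y|) (p - 1)) hy]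
  unfold doobPotential
  linarith

/-- The constant in the one-step estimate for `doobPotential`. -/
noncomputable def stepConst (p : ℝ) : ℝ :=
  (4 ^ p + 1) * (p * (p - 1) * 2 ^ p + 2 ^ p + p)

theorem stepConst_pos {p : ℝ} (hp : 2 ≤ p) : 0 < stepConst p := by
  have : 0 < p - 1 := by linarith
  unfold stepConst
  positivity

theorem doobPotential_step {p m b : ℝ} (hp : 2 ≤ p) (hm : 0 ≤ m) (hb : 0 < b) (s x : ℝ) :
    doobPotential p (max m (s + x)) (s + x) ≤ doobPotential p m s
      + ((-2) * |m| ^ (p - 1) + (4 ^ p + 1) * p * oddPow (p - 1) s) * x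
      + (stepConst p * (1 / b) * (|s| ^ p * x ^ 2)
        + (stepConst p * b ^ (p / 2 - 1) * x ^ 2 + stepConst p * |x| ^ p)) := by
  have h1 := doob_step hp hm (s + x)
  have h2 := abs_add_rpow_le hp s x
  have h3 := mul_le_mul_of_nonneg_right (abs_rpow_sub_two_le hp hb s) (sq_nonneg x)
  have h4 : (0 : ℝ) < 4 ^ p + 1 := by positivity
  have h5 := mul_le_mul_of_nonneg_left h2 h4.le
  have h6 := mul_le_mul_of_nonneg_left h3 (stepConst_pos hp).le
  have h7 : (4 ^ p + 1) * ((p * (p - 1) * 2 ^ p + 2 ^ p + p) * (|s| ^ (p - 2) * x ^ 2 + |x| ^ p))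
      = stepConst p * (|s| ^ (p - 2) * x ^ 2) + stepConst p * |x| ^ p := by
    unfold stepConst; ring
  have h8 : stepConst p * ((|s| ^ p / b + b ^ (p / 2 - 1)) * x ^ 2)
      = stepConst p * (1 / b) * (|s| ^ p * x ^ 2) + stepConst p * b ^ (p / 2 - 1) * x ^ 2 := by
    ring
  unfold doobPotential
  linarith

namespace SubLinExp

variable {Ω : Type*} (S : SubLinExp Ω)

/-- `Z` is a local Lipschitz function of `X₁,…,X_k`. -/
def Adapted (X : ℕ → Ω → ℝ) (k : ℕ) (Z : Ω → ℝ) : Prop :=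
  ∃ φ : (Fin k → ℝ) → ℝ, LocLip φ ∧ Z = fun ω => φ (fun i => X ((i : ℕ) + 1) ω)

namespace Adapted

variable {X : ℕ → Ω → ℝ} {k : ℕ} {Z W : Ω → ℝ}

theorem const (c : ℝ) : Adapted X k (fun _ => c) := ⟨_, .const c, rfl⟩

theorem add (hZ : Adapted X k Z) (hW : Adapted X k W) : Adapted X k (fun ω => Z ω + W ω) := by
  obtain ⟨φ, hφ, rfl⟩ := hZ
  obtain ⟨ψ, hψ, rfl⟩ := hW
  exact ⟨_, hφ.add hψ, rfl⟩

theorem mul (hZ : Adapted X k Z) (hW : Adapted X k W) : Adapted X k (fun ω => Z ω * W ω) := by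
  obtain ⟨φ, hφ, rfl⟩ := hZ
  obtain ⟨ψ, hψ, rfl⟩ := hW
  exact ⟨_, hφ.mul hψ, rfl⟩

theorem const_mul (c : ℝ) (hZ : Adapted X k Z) : Adapted X k (fun ω => c * Z ω) :=
  (const c).mul hZ

theorem sup (hZ : Adapted X k Z) (hW : Adapted X k W) :
    Adapted X k (fun ω => max (Z ω) (W ω)) := by
  obtain ⟨φ, hφ, rfl⟩ := hZ
  obtain ⟨ψ, hψ, rfl⟩ := hW
  exact ⟨_, hφ.sup hψ, rfl⟩

theorem comp {f : ℝ → ℝ} (hf : LocLip f) (hZ : Adapted X k Z) : Adapted X k (fun ω => f (Z ω)) := by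
  obtain ⟨φ, hφ, rfl⟩ := hZ
  exact ⟨_, hf.comp hφ, rfl⟩

theorem mono {l : ℕ} (hkl : k ≤ l) (hZ : Adapted X k Z) : Adapted X l Z := by
  obtain ⟨φ, hφ, rfl⟩ := hZ
  refine ⟨fun x => φ (fun i => x (Fin.castLE hkl i)), hφ.comp_of_norm_le (fun x => ?_)
    (fun x y => ?_), rfl⟩
  · exact (pi_norm_le_iff_of_nonneg (norm_nonneg _)).2 fun i => norm_le_pi_norm x _
  · exact (pi_norm_le_iff_of_nonneg (norm_nonneg _)).2 fun i => norm_le_pi_norm (x - y) _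

theorem self (X : ℕ → Ω → ℝ) (k : ℕ) : Adapted X (k + 1) (X (k + 1)) :=
  ⟨fun x => x (Fin.last k), LocLip.id.comp_of_norm_le (fun x => norm_le_pi_norm x _)
    (fun x y => norm_le_pi_norm (x - y) _), rfl⟩

theorem sum_Icc (X : ℕ → Ω → ℝ) (k : ℕ) : Adapted X k (fun ω => ∑ i ∈ Finset.Icc 1 k, X i ω) := by
  induction k with
  | zero => simpa using const 0
  | succ k ih =>
    simp_rw [Finset.sum_Icc_succ_top (Nat.le_add_left 1 k)]
    exact (ih.mono k.le_succ).add (self X k)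

theorem mem (hZ : Adapted X k Z) (hX : ∀ i, 1 ≤ i → i ≤ k → X i ∈ S.H) : Z ∈ S.H := by
  obtain ⟨φ, hφ, rfl⟩ := hZ
  exact S.comp_mem k (fun i => X ((i : ℕ) + 1))
    (fun i => hX _ (Nat.le_add_left 1 _) i.isLt) φ hφ

end Adapted

variable {S} {X : ℕ → Ω → ℝ} {n k : ℕ} {Z : Ω → ℝ}

theorem E_nonneg (hZ : Z ∈ S.H) (h : ∀ ω, 0 ≤ Z ω) : 0 ≤ S.E Z := by
  simpa [S.const] using S.mono Z hZ _ (S.const_mem 0) h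

theorem _root_.IndepUpTo1.indepVecOf (hI : IndepUpTo1 S X n) (hk : k + 1 ≤ n) :
    IndepVecOf S (X (k + 1)) (fun j : Fin k => X ((j : ℕ) + 1)) := by
  rcases Nat.eq_zero_or_pos k with rfl | h
  · intro φ _
    simp only [Subsingleton.elim (fun i : Fin 0 => X ((i : ℕ) + 1) _) default, S.const]
  · exact hI k h hk

/-- The next variable is a martingale difference. -/
theorem E_adapted_mul_next (hX : ∀ i, 1 ≤ i → i ≤ n → X i ∈ S.H) (hI : IndepUpTo1 S X n)
    (hk : k + 1 ≤ n) (h0 : S.E (X (k + 1)) = 0) (h0' : S.E (fun ω => -X (k + 1) ω) = 0)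
    (hZ : Adapted X k Z) : S.E (fun ω => Z ω * X (k + 1) ω) = 0 := by
  obtain ⟨φ, hφ, rfl⟩ := hZ
  have hmem : X (k + 1) ∈ S.H := hX _ (Nat.le_add_left 1 k) hk
  have hmem' : (fun ω => -X (k + 1) ω) ∈ S.H := by
    have := ((Adapted.self X k).const_mul (-1)).mem S (fun i h1 h2 => hX i h1 (h2.trans hk))
    simpa using this
  have key : ∀ c : ℝ, S.E (fun ω => c * X (k + 1) ω) = 0 := fun c => by
    rcases le_total 0 c with hc | hc
    · rw [S.homog c hc _ hmem, h0, mul_zero]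
    · have := S.homog (-c) (by linarith) _ hmem'
      rw [h0', mul_zero] at this
      simpa using this
  refine (hI.indepVecOf hk (fun x y => φ x * y) (hφ.comp_fst.mul LocLip.id.comp_snd)).trans ?_
  simp only [key, S.const]

theorem E_adapted_mul_comp_next (hX : ∀ i, 1 ≤ i → i ≤ n → X i ∈ S.H) (hI : IndepUpTo1 S X n)
    (hk : k + 1 ≤ n) {f : ℝ → ℝ} (hf : LocLip f) (hf0 : ∀ r, 0 ≤ f r)
    (hZ : Adapted X k Z) (hZ0 : ∀ ω, 0 ≤ Z ω) :
    S.E (fun ω => Z ω * f (X (k + 1) ω)) = S.E (fun ω => f (X (k + 1) ω)) * S.E Z := by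
  have hmem : (fun ω => f (X (k + 1) ω)) ∈ S.H :=
    ((Adapted.self X k).comp hf).mem S (fun i h1 h2 => hX i h1 (h2.trans hk))
  have hZmem : Z ∈ S.H := hZ.mem S (fun i h1 h2 => hX i h1 (h2.trans (by omega)))
  rw [← S.homog _ (E_nonneg hmem fun ω => hf0 _) Z hZmem]
  obtain ⟨φ, hφ, rfl⟩ := hZ
  refine (hI.indepVecOf hk (fun x y => φ x * f y) (hφ.comp_fst.mul hf.comp_snd)).trans ?_
  congr 1
  funext ω
  rw [S.homog _ (hZ0 ω) _ hmem, mul_comm]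

end SubLinExp

/-- A discrete Gronwall inequality. -/
theorem le_exp_mul_of_succ_le {n : ℕ} {u σ a : ℕ → ℝ} {D b β : ℝ} (hD : 0 ≤ D) (hb : 0 < b)
    (hβ : 0 ≤ β) (hσ : ∀ k, 1 ≤ k → k ≤ n → 0 ≤ σ k) (ha : ∀ k, 1 ≤ k → k ≤ n → 0 ≤ a k)
    (h0 : u 0 ≤ 0)
    (h : ∀ k, k + 1 ≤ n →
      u (k + 1) ≤ (1 + D * σ (k + 1) / b) * u k + D * (β * σ (k + 1) + a (k + 1))) :
    u n ≤ Real.exp (D * (∑ i ∈ Finset.Icc 1 n, σ i) / b) *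
      (D * (β * (∑ i ∈ Finset.Icc 1 n, σ i) + ∑ i ∈ Finset.Icc 1 n, a i)) := by
  induction n with
  | zero => simpa using h0
  | succ n ih =>
    have ih := ih (fun k h1 h2 => hσ k h1 (by omega)) (fun k h1 h2 => ha k h1 (by omega))
      (fun k hk => h k (by omega))
    have hs := hσ (n + 1) (by omega) le_rfl
    have hA := ha (n + 1) (by omega) le_rfl
    have hB : 0 ≤ ∑ i ∈ Finset.Icc 1 n, σ i := Finset.sum_nonneg fun i hi =>
      hσ i (Finset.mem_Icc.1 hi).1 ((Finset.mem_Icc.1 hi).2.trans n.le_succ)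
    have hAs : 0 ≤ ∑ i ∈ Finset.Icc 1 n, a i := Finset.sum_nonneg fun i hi =>
      ha i (Finset.mem_Icc.1 hi).1 ((Finset.mem_Icc.1 hi).2.trans n.le_succ)
    rw [Finset.sum_Icc_succ_top (by omega), Finset.sum_Icc_succ_top (by omega)]
    set B := ∑ i ∈ Finset.Icc 1 n, σ i
    set A := ∑ i ∈ Finset.Icc 1 n, a i
    set s := σ (n + 1)
    set t := a (n + 1)
    have he : 1 + D * s / b ≤ Real.exp (D * s / b) := by
      linarith [Real.add_one_le_exp (D * s / b)]
    have he' : (1 : ℝ) ≤ Real.exp (D * (B + s) / b) := Real.one_le_exp (by positivity)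
    have hst : 0 ≤ D * (β * s + t) := by positivity
    calc u (n + 1) ≤ (1 + D * s / b) * u n + D * (β * s + t) := h n le_rfl
      _ ≤ Real.exp (D * s / b) * (Real.exp (D * B / b) * (D * (β * B + A)))
          + Real.exp (D * (B + s) / b) * (D * (β * s + t)) := by
        refine add_le_add ?_ (le_mul_of_one_le_left hst he')
        refine (mul_le_mul_of_nonneg_left ih (by positivity)).trans ?_
        gcongr
      _ = _ := by
        rw [← mul_assoc, ← Real.exp_add, show D * s / b + D * B / b = D * (B + s) / b by ring]
        ring

/-- The running maximum `max (0, ε S₁, …, ε S_k)` of the partial sums of `X₁, X₂, …`. -/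
noncomputable def runMax {Ω : Type*} (X : ℕ → Ω → ℝ) (ε : ℝ) : ℕ → Ω → ℝ
  | 0 => fun _ => 0
  | k + 1 => fun ω => max (runMax X ε k ω) (ε * ∑ i ∈ Finset.Icc 1 (k + 1), X i ω)

section runMax

variable {Ω : Type*} (X : ℕ → Ω → ℝ) (ε : ℝ)

theorem runMax_nonneg (k : ℕ) (ω : Ω) : 0 ≤ runMax X ε k ω := by
  induction k with
  | zero => exact le_rfl
  | succ k ih => exact le_max_of_le_left ih

theorem le_runMax {j k : ℕ} (hj : 1 ≤ j) (hjk : j ≤ k) (ω : Ω) :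
    ε * ∑ i ∈ Finset.Icc 1 j, X i ω ≤ runMax X ε k ω := by
  induction k with
  | zero => omega
  | succ k ih =>
    rcases hjk.eq_or_lt with rfl | h
    · exact le_max_right _ _
    · exact le_max_of_le_left (ih (by omega))

theorem adapted_runMax (k : ℕ) : SubLinExp.Adapted X k (runMax X ε k) := by
  induction k with
  | zero => exact .const 0
  | succ k ih => exact (ih.mono k.le_succ).sup ((SubLinExp.Adapted.sum_Icc X _).const_mul ε)

end runMax

/-- `doobPotential` evaluated along the partial sums of `X₁, X₂, …`. -/
noncomputable def sumPotential {Ω : Type*} (X : ℕ → Ω → ℝ) (p ε : ℝ) (k : ℕ) (ω : Ω) : ℝ :=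
  doobPotential p (runMax X ε k ω) (ε * ∑ i ∈ Finset.Icc 1 k, X i ω)

theorem adapted_sumPotential {Ω : Type*} (X : ℕ → Ω → ℝ) {p : ℝ} (hp : 2 ≤ p) (ε : ℝ) (k : ℕ) :
    SubLinExp.Adapted X k (sumPotential X p ε k) := by
  have hM := adapted_runMax X ε k
  have hS := (SubLinExp.Adapted.sum_Icc X k).const_mul ε
  have h := ((hM.comp (locLip_abs_rpow (q := p) (by linarith))).add
    (((hM.comp (locLip_abs_rpow (q := p - 1) (by linarith))).const_mul (-2)).mul hS)).add
    ((hS.comp (locLip_abs_rpow (q := p) (by linarith))).const_mul (4 ^ p + 1))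
  convert h using 2
  unfold sumPotential doobPotential
  ring

namespace SubLinExp

variable {Ω : Type*} {S : SubLinExp Ω} {X : ℕ → Ω → ℝ} {n k : ℕ} {p ε b : ℝ}

theorem E_sumPotential_succ_le (hX : ∀ i, 1 ≤ i → i ≤ n → X i ∈ S.H) (hI : IndepUpTo1 S X n)
    (hmean : ∀ k, 1 ≤ k → k ≤ n → S.E (X k) = 0 ∧ S.E (fun ω => -X k ω) = 0)
    (hp : 2 ≤ p) (hε : |ε| = 1) (hb : 0 < b) (hk : k + 1 ≤ n) :
    S.E (sumPotential X p ε (k + 1)) ≤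
      (1 + stepConst p * (S.E fun ω => X (k + 1) ω ^ 2) / b) * S.E (sumPotential X p ε k)
        + stepConst p * (b ^ (p / 2 - 1) * (S.E fun ω => X (k + 1) ω ^ 2)
          + S.E fun ω => |X (k + 1) ω| ^ p) := by
  set D := stepConst p
  have hD : 0 < D := stepConst_pos hp
  have hε2 : ε ^ 2 = 1 := by rw [← sq_abs, hε, one_pow]
  have hmem : ∀ {Z : Ω → ℝ}, Adapted X (k + 1) Z → Z ∈ S.H := fun hZ =>
    hZ.mem S (fun i h1 h2 => hX i h1 (h2.trans hk))
  have hp1 : LocLip (fun r : ℝ => |r| ^ p) := locLip_abs_rpow (by linarith)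
  set T : Ω → ℝ := fun ω => ε * ∑ i ∈ Finset.Icc 1 k, X i ω
  set Y := X (k + 1)
  set U := sumPotential X p ε k
  have hU : Adapted X k U := adapted_sumPotential X hp ε k
  have hU' : U ∈ S.H := hmem (hU.mono k.le_succ)
  have hT : Adapted X k T := (Adapted.sum_Icc X k).const_mul ε
  have hTp : Adapted X k (fun ω => |T ω| ^ p) := hT.comp hp1
  have hTp' : (fun ω => |T ω| ^ p) ∈ S.H := hmem (hTp.mono k.le_succ)
  set G : Ω → ℝ := fun ω => ((-2) * |runMax X ε k ω| ^ (p - 1)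
    + (4 ^ p + 1) * p * oddPow (p - 1) (T ω)) * ε
  have hG : Adapted X k G :=
    (((((adapted_runMax X ε k).comp (locLip_abs_rpow (q := p - 1) (by linarith))).const_mul
      (-2)).add ((hT.comp (locLip_oddPow (q := p - 1) (by linarith))).const_mul
        ((4 ^ p + 1) * p)))).mul (.const ε)
  have hY : Adapted X (k + 1) Y := Adapted.self X k
  have hGY := hmem ((hG.mono k.le_succ).mul hY)
  have hY2 := hmem (hY.comp LocLip.sq)
  have hYp := hmem (hY.comp hp1)
  have hTY := hmem ((hTp.mono k.le_succ).mul (hY.comp LocLip.sq))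
  have hc1 : 0 ≤ D * (1 / b) := by positivity
  have hc2 : 0 ≤ D * b ^ (p / 2 - 1) := by positivity
  have hc1m := hmem (((hTp.mono k.le_succ).mul (hY.comp LocLip.sq)).const_mul (D * (1 / b)))
  have hc2m := hmem ((hY.comp LocLip.sq).const_mul (D * b ^ (p / 2 - 1)))
  have hc3m := hmem ((hY.comp hp1).const_mul D)
  have hr2 := hmem (((hY.comp LocLip.sq).const_mul (D * b ^ (p / 2 - 1))).add
    ((hY.comp hp1).const_mul D))
  have hr1 := hmem ((((hTp.mono k.le_succ).mul (hY.comp LocLip.sq)).const_mul (D * (1 / b))).add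
    (((hY.comp LocLip.sq).const_mul (D * b ^ (p / 2 - 1))).add ((hY.comp hp1).const_mul D)))
  have hUG := hmem ((hU.mono k.le_succ).add ((hG.mono k.le_succ).mul hY))
  have hall := hmem (((hU.mono k.le_succ).add ((hG.mono k.le_succ).mul hY)).add
    ((((hTp.mono k.le_succ).mul (hY.comp LocLip.sq)).const_mul (D * (1 / b))).add
    (((hY.comp LocLip.sq).const_mul (D * b ^ (p / 2 - 1))).add ((hY.comp hp1).const_mul D))))
  have hpt := S.mono _ hall _ (hmem (adapted_sumPotential X hp ε (k + 1))) fun ω => by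
    have h := doobPotential_step hp (runMax_nonneg X ε k ω) hb (T ω) (ε * Y ω)
    have hsum : ε * ∑ i ∈ Finset.Icc 1 (k + 1), X i ω = T ω + ε * Y ω := by
      rw [Finset.sum_Icc_succ_top (Nat.le_add_left 1 k), mul_add]
    rw [mul_pow, hε2, one_mul, abs_mul ε (Y ω), hε, one_mul, ← mul_assoc] at h
    simp only [sumPotential, runMax, hsum]
    exact h
  have e1 := S.subadd _ hUG _ hr1
  have e2 := S.subadd _ hU' _ hGY
  have e3 := S.subadd _ hc1m _ hr2
  have e4 := S.subadd _ hc2m _ hc3m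
  have e5 := S.homog _ hc1 _ hTY
  have e6 := S.homog _ hc2 _ hY2
  have e7 := S.homog _ hD.le _ hYp
  have hm := hmean (k + 1) (Nat.le_add_left 1 k) hk
  have e8 := E_adapted_mul_next hX hI hk hm.1 hm.2 hG
  have e9 := E_adapted_mul_comp_next hX hI hk LocLip.sq sq_nonneg hTp
    (fun ω => Real.rpow_nonneg (abs_nonneg _) p)
  have e10 : S.E (fun ω => |T ω| ^ p) ≤ S.E U := S.mono _ hU' _ hTp' fun ω => by
    have h := add_le_doobPotential hp (runMax X ε k ω) (T ω)
    have : 0 ≤ |runMax X ε k ω| ^ p := by positivity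
    exact le_trans (by linarith) h
  have hv : 0 ≤ S.E (fun ω => Y ω ^ 2) := E_nonneg hY2 fun ω => sq_nonneg _
  have e11 : D * (1 / b) * (S.E (fun ω => Y ω ^ 2) * S.E (fun ω => |T ω| ^ p))
      ≤ D * (1 / b) * (S.E (fun ω => Y ω ^ 2) * S.E U) := by gcongr
  have e12 : D * (1 / b) * (S.E (fun ω => Y ω ^ 2) * S.E U)
      = D * S.E (fun ω => Y ω ^ 2) / b * S.E U := by ring
  rw [e9] at e5
  linarith

theorem E_sumPotential_le (hX : ∀ i, 1 ≤ i → i ≤ n → X i ∈ S.H) (hI : IndepUpTo1 S X n)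
    (hmean : ∀ k, 1 ≤ k → k ≤ n → S.E (X k) = 0 ∧ S.E (fun ω => -X k ω) = 0)
    (hp : 2 ≤ p) (hε : |ε| = 1) :
    S.E (sumPotential X p ε n) ≤ Real.exp (stepConst p) * stepConst p *
      ((∑ k ∈ Finset.Icc 1 n, S.E fun ω => |X k ω| ^ p)
        + (∑ k ∈ Finset.Icc 1 n, S.E fun ω => X k ω ^ 2) ^ (p / 2)) := by
  set D := stepConst p
  have hD : 0 < D := stepConst_pos hp
  have hmem : ∀ f : ℝ → ℝ, LocLip f → ∀ k, 1 ≤ k → k ≤ n → (fun ω => f (X k ω)) ∈ S.H := by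
    intro f hf k h1 h2
    obtain ⟨j, rfl⟩ : ∃ j, k = j + 1 := ⟨k - 1, by omega⟩
    exact ((Adapted.self X j).comp hf).mem S fun i hi hij => hX i hi (hij.trans h2)
  have hσ : ∀ k, 1 ≤ k → k ≤ n → 0 ≤ S.E fun ω => X k ω ^ 2 := fun k h1 h2 =>
    E_nonneg (hmem _ LocLip.sq k h1 h2) fun ω => sq_nonneg _
  have ha : ∀ k, 1 ≤ k → k ≤ n → 0 ≤ S.E fun ω => |X k ω| ^ p := fun k h1 h2 =>
    E_nonneg (hmem _ (locLip_abs_rpow (by linarith)) k h1 h2) fun ω => by positivity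
  set B := ∑ k ∈ Finset.Icc 1 n, S.E fun ω => X k ω ^ 2
  set A := ∑ k ∈ Finset.Icc 1 n, S.E fun ω => |X k ω| ^ p
  have hB : 0 ≤ B := Finset.sum_nonneg fun k hk =>
    hσ k (Finset.mem_Icc.1 hk).1 (Finset.mem_Icc.1 hk).2
  have hA : 0 ≤ A := Finset.sum_nonneg fun k hk =>
    ha k (Finset.mem_Icc.1 hk).1 (Finset.mem_Icc.1 hk).2
  have h0 : S.E (sumPotential X p ε 0) ≤ 0 := by
    have hz : sumPotential X p ε 0 = fun _ => 0 := by
      funext ω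
      simp [sumPotential, doobPotential, runMax, Real.zero_rpow (by linarith : p ≠ 0)]
    rw [hz, S.const]
  have key : ∀ b, B < b → S.E (sumPotential X p ε n) ≤
      Real.exp D * D * (A + b ^ (p / 2)) := fun b hBb => by
    have hb : 0 < b := hB.trans_lt hBb
    have h := le_exp_mul_of_succ_le (n := n) (u := fun k => S.E (sumPotential X p ε k)) hD.le hb
      (by positivity : 0 ≤ b ^ (p / 2 - 1)) hσ ha h0
      fun k hk => E_sumPotential_succ_le hX hI hmean hp hε hb hk
    refine h.trans ?_
    rw [mul_assoc]
    have h1 : D * B / b ≤ D := by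
      rw [div_le_iff₀ hb]; gcongr
    have h2 : b ^ (p / 2 - 1) * B ≤ b ^ (p / 2) := by
      calc b ^ (p / 2 - 1) * B ≤ b ^ (p / 2 - 1) * b := by gcongr
        _ = b ^ (p / 2) := by
          rw [← Real.rpow_add_one hb.ne', sub_add_cancel]
    have h3 : D * (b ^ (p / 2 - 1) * B + A) ≤ D * (A + b ^ (p / 2)) :=
      mul_le_mul_of_nonneg_left (by linarith) hD.le
    exact mul_le_mul (Real.exp_le_exp.2 h1) h3 (by positivity) (by positivity)
  have hcont : Continuous fun b : ℝ => Real.exp D * D * (A + b ^ (p / 2)) :=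
    continuous_const.mul (continuous_const.add (Real.continuous_rpow_const (by linarith)))
  exact ge_of_tendsto (hcont.continuousWithinAt (s := Set.Ioi B) (x := B))
    (eventually_nhdsWithin_of_forall key)

end SubLinExp

/-- Rosenthal-type maximal inequality: for every `p ≥ 2` there is a constant `C_p > 0`,
depending only on `p`, such that for all independent `X₁,…,Xₙ` with
`Ê(Xᵢ) = ε̂(Xᵢ) = 0`,
`Ê(max_{k≤n} |Sₖ|^p) ≤ C_p (Σ_{k=1}^n Ê(|Xₖ|^p) + (Σ_{k=1}^n Ê(Xₖ²))^{p/2})`. -/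
theorem rosenthal_maximal_inequality (p : ℝ) (hp : 2 ≤ p) :
    ∃ C : ℝ, 0 < C ∧
      ∀ (Ω : Type*) (S : SubLinExp Ω) (n : ℕ) (hn : 1 ≤ n) (X : ℕ → Ω → ℝ),
        (∀ k, 1 ≤ k → k ≤ n → X k ∈ S.H) →
        IndepUpTo1 S X n →
        (∀ k, 1 ≤ k → k ≤ n → S.E (X k) = 0 ∧ S.E (fun ω => -X k ω) = 0) →
        S.E (fun ω => (Finset.Icc 1 n).sup' (Finset.nonempty_Icc.mpr hn)
              (fun k => |∑ i ∈ Finset.Icc 1 k, X i ω| ^ p))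
          ≤ C * ((∑ k ∈ Finset.Icc 1 n, S.E fun ω => |X k ω| ^ p)
              + (∑ k ∈ Finset.Icc 1 n, S.E fun ω => (X k ω) ^ 2) ^ (p / 2)) := by

  refine ⟨4 * (Real.exp (stepConst p) * stepConst p),
    by have := stepConst_pos hp; positivity, ?_⟩
  intro Ω S n hn X hX hI hmean
  have hmem : ∀ {Z : Ω → ℝ}, SubLinExp.Adapted X n Z → Z ∈ S.H := fun hZ => hZ.mem S hX
  have hU := adapted_sumPotential X hp 1 n
  have hV := adapted_sumPotential X hp (-1) n
  have hmax : SubLinExp.Adapted X n (fun ω => (Finset.Icc 1 n).sup' (Finset.nonempty_Icc.mpr hn)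
      (fun k => |∑ i ∈ Finset.Icc 1 k, X i ω| ^ p)) := by
    have h := Finset.sup'_induction (Finset.nonempty_Icc.mpr hn)
      (fun k ω => |∑ i ∈ Finset.Icc 1 k, X i ω| ^ p) (p := SubLinExp.Adapted X n)
      (fun _ h _ h' => h.sup h') fun k hk =>
        ((SubLinExp.Adapted.sum_Icc X k).comp (locLip_abs_rpow (by linarith))).mono
          (Finset.mem_Icc.1 hk).2
    convert h using 1
    funext ω
    rw [Finset.sup'_apply]
  have hle := S.mono _ (hmem ((hU.const_mul 2).add (hV.const_mul 2))) _ (hmem hmax) fun ω => by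
    refine Finset.sup'_le _ _ fun k hk => ?_
    obtain ⟨hk1, hkn⟩ := Finset.mem_Icc.1 hk
    have hbound : ∀ ε : ℝ, |runMax X ε n ω| ^ p ≤ 2 * sumPotential X p ε n ω := fun ε => by
      have h := add_le_doobPotential hp (runMax X ε n ω) (ε * ∑ i ∈ Finset.Icc 1 n, X i ω)
      have h' : 0 ≤ |ε * ∑ i ∈ Finset.Icc 1 n, X i ω| ^ p := by positivity
      unfold sumPotential
      linarith
    have hpow : ∀ ε : ℝ, |∑ i ∈ Finset.Icc 1 k, X i ω| = ε * ∑ i ∈ Finset.Icc 1 k, X i ω →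
        |∑ i ∈ Finset.Icc 1 k, X i ω| ^ p ≤ |runMax X ε n ω| ^ p := fun ε hε =>
      Real.rpow_le_rpow (abs_nonneg _)
        (hε.trans_le ((le_runMax X ε hk1 hkn ω).trans (le_abs_self _))) (by linarith)
    have h1 := hbound 1
    have h2 := hbound (-1)
    have h1' : 0 ≤ |runMax X 1 n ω| ^ p := by positivity
    have h2' : 0 ≤ |runMax X (-1) n ω| ^ p := by positivity
    rcases abs_choice (∑ i ∈ Finset.Icc 1 k, X i ω) with h | h
    · linarith [hpow 1 (by rw [h, one_mul])]
    · linarith [hpow (-1) (by rw [h, neg_one_mul])]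
  have hsub := S.subadd _ (hmem (hU.const_mul 2)) _ (hmem (hV.const_mul 2))
  have hU2 := S.homog 2 zero_le_two _ (hmem hU)
  have hV2 := S.homog 2 zero_le_two _ (hmem hV)
  have bU := SubLinExp.E_sumPotential_le hX hI hmean hp (ε := 1) (by simp)
  have bV := SubLinExp.E_sumPotential_le hX hI hmean hp (ε := -1) (by simp)
  linarith
end
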